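/- arXiv:2511.08211 — 2 statements merged into one kernel-verified Lean document; each statement's English description precedes it below -/
import Mathlib

section
/- Let 1 < σ < 2, let p, q be integers with 2 ≤ p < q, and let a₁, a₂ ∈ ℝ. Define G_σ(x) := (1/(2π)) ∫_ℝ e^{iξx}/(1 + |ξ|^σ) dξ. Suppose φ : ℝ → ℝ is infinitely differentiable with φ and all of its derivatives bounded on ℝ, φ(x) → 0 as |x| → ∞, and φ(x) = ∫_ℝ G_σ(x − y) (a₁ φ(y)^p + a₂ φ(y)^q) dy for all x ∈ ℝ. Then for every nonnegative integer l there exists a constant C_l > 0 such that |∂_x^l φ(x)| ≤ C_l ⟨x⟩^{−(1+σ)} for all x ∈ ℝ. -/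
open MeasureTheory Filter Real

/-- `G_σ(x) = (1/(2π)) ∫_ℝ e^{iξx}/(1 + |ξ|^σ) dξ` (a real number, taken as the real part
of the absolutely convergent complex integral). -/
noncomputable def Gsigma (σ : ℝ) (x : ℝ) : ℝ :=
  (1 / (2 * π)) *
    (∫ ξ : ℝ, Complex.exp (Complex.I * (ξ : ℂ) * (x : ℂ)) / ((1 + |ξ| ^ σ : ℝ) : ℂ)).re

lemma aux_lower (σ : ℝ) (hσ1 : 1 < σ) (hσ2 : σ < 2) : ∃ c : ℝ, 0 < c ∧ ∀ z : ℂ, 0 ≤ z.re →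
    0 ≤ z.im → c ≤ ‖1 + z ^ (σ : ℂ)‖ ∧ c * ‖z‖ ^ σ ≤ ‖1 + z ^ (σ : ℂ)‖ := by
  have hpi := Real.pi_pos
  have hk0 : Real.cos (σ * (π / 2)) < 0 := by
    apply Real.cos_neg_of_pi_div_two_lt_of_lt <;> nlinarith
  have hk1 : -1 < Real.cos (σ * (π / 2)) := by
    rw [← Real.cos_pi]
    apply Real.cos_lt_cos_of_nonneg_of_le_pi <;> nlinarith
  set κ := - Real.cos (σ * (π / 2)) with hκ
  refine ⟨Real.sqrt (1 - κ), Real.sqrt_pos.2 (by linarith), fun z hre him => ?_⟩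
  have key : (1 - κ) * (1 + (‖z‖ ^ σ) ^ 2) ≤ ‖1 + z ^ (σ : ℂ)‖ ^ 2 := by
    by_cases hz : z = 0
    · subst hz
      have h0 : (σ : ℂ) ≠ 0 := by exact_mod_cast (by linarith : σ ≠ 0)
      have h0' : σ ≠ 0 := by linarith
      simp [Complex.zero_cpow h0, Real.zero_rpow h0']
      linarith
    set ρ := ‖z‖ ^ σ with hρ
    have hρ0 : 0 ≤ ρ := by positivity
    have ha0 : 0 ≤ z.arg := Complex.arg_nonneg_iff.2 him
    have ha1 : z.arg ≤ π / 2 := (Complex.abs_arg_le_pi_div_two_iff.2 hre |> abs_le.1).2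
    have hcos : -κ ≤ Real.cos (z.arg * σ) := by
      rw [hκ, neg_neg]
      apply Real.cos_le_cos_of_nonneg_of_le_pi <;> nlinarith
    have hform : z ^ (σ : ℂ) = (ρ : ℂ) * Complex.exp ((z.arg * σ : ℝ) * Complex.I) := by
      have := Complex.norm_mul_exp_arg_mul_I (z ^ (σ : ℂ))
      rw [Complex.cpow_def_of_ne_zero hz, hρ, Real.rpow_def_of_pos (norm_pos_iff.2 hz)]
      push_cast
      rw [← Complex.exp_add]
      congr 1
      rw [Complex.log]
      ring
    have hre' : (z ^ (σ : ℂ)).re = ρ * Real.cos (z.arg * σ) := by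
      rw [hform, Complex.re_ofReal_mul, Complex.exp_ofReal_mul_I_re]
    have him' : (z ^ (σ : ℂ)).im = ρ * Real.sin (z.arg * σ) := by
      rw [hform, Complex.im_ofReal_mul, Complex.exp_ofReal_mul_I_im]
    rw [← Complex.normSq_eq_norm_sq, Complex.normSq_apply]
    simp only [Complex.add_re, Complex.add_im, Complex.one_re, Complex.one_im, hre', him']
    have := Real.sin_sq_add_cos_sq (z.arg * σ)
    nlinarith [sq_nonneg (1 - ρ), mul_le_mul_of_nonneg_left hcos hρ0]
  have h1k : 0 < 1 - κ := by linarith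
  have hs := Real.sq_sqrt h1k.le
  constructor
  · refine abs_le_of_sq_le_sq' ?_ (norm_nonneg _) |>.2
    rw [hs]
    nlinarith [sq_nonneg (‖z‖ ^ σ)]
  · refine abs_le_of_sq_le_sq' ?_ (norm_nonneg _) |>.2
    rw [mul_pow, hs]
    nlinarith [sq_nonneg (‖z‖ ^ σ)]

lemma aux_m_integrable (σ : ℝ) (hσ1 : 1 < σ) : Integrable (fun ξ : ℝ => (1 + |ξ| ^ σ)⁻¹) := by
  have h := (integrable_one_add_norm (E := ℝ) (μ := volume) (r := σ) (by simpa using hσ1)).const_mul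
    (2 ^ σ)
  have hσ0 : 0 ≤ σ := by linarith
  refine h.mono' ?_ (ae_of_all _ fun ξ => ?_)
  · apply Continuous.aestronglyMeasurable
    refine Continuous.inv₀ ?_ ?_
    · exact continuous_const.add (continuous_abs.rpow_const fun _ => Or.inr hσ0)
    · intro x; positivity
  · have hb := abs_nonneg ξ
    rw [Real.norm_of_nonneg (by positivity), Real.norm_eq_abs, Real.rpow_neg (by positivity),
      ← div_eq_mul_inv, inv_eq_one_div, div_le_div_iff₀ (by positivity) (by positivity), one_mul]
    rcases le_total (|ξ|) 1 with h1 | h1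
    · calc (1 + |ξ|) ^ σ ≤ 2 ^ σ := by gcongr; linarith
        _ ≤ 2 ^ σ * (1 + |ξ| ^ σ) := by
          have : 0 ≤ (2:ℝ) ^ σ * |ξ| ^ σ := by positivity
          linarith
    · calc (1 + |ξ|) ^ σ ≤ (2 * |ξ|) ^ σ := by gcongr; linarith
        _ = 2 ^ σ * |ξ| ^ σ := by rw [Real.mul_rpow (by norm_num) hb]
        _ ≤ 2 ^ σ * (1 + |ξ| ^ σ) := by gcongr; linarith

lemma aux_G_integrand_norm (σ : ℝ) (x ξ : ℝ) :
    ‖Complex.exp (Complex.I * (ξ : ℂ) * (x : ℂ)) / ((1 + |ξ| ^ σ : ℝ) : ℂ)‖ = (1 + |ξ| ^ σ)⁻¹ := by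
  rw [norm_div, Complex.norm_real, Real.norm_of_nonneg (by positivity)]
  have : Complex.I * (ξ : ℂ) * (x : ℂ) = ((ξ * x : ℝ) : ℂ) * Complex.I := by push_cast; ring
  rw [this, Complex.norm_exp_ofReal_mul_I, one_div]

lemma aux_G_integrand_cont (σ : ℝ) (hσ1 : 1 < σ) (x : ℝ) : Continuous fun ξ : ℝ =>
    Complex.exp (Complex.I * (ξ : ℂ) * (x : ℂ)) / ((1 + |ξ| ^ σ : ℝ) : ℂ) := by
  have hσ0 : 0 ≤ σ := by linarith
  refine Continuous.div (by fun_prop) ?_ ?_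
  · exact Complex.continuous_ofReal.comp
      (continuous_const.add (continuous_abs.rpow_const fun _ => Or.inr hσ0))
  · intro ξ
    have : 0 < 1 + |ξ| ^ σ := by positivity
    exact_mod_cast this.ne'

lemma aux_G_integrable (σ : ℝ) (hσ1 : 1 < σ) (x : ℝ) : Integrable fun ξ : ℝ =>
    Complex.exp (Complex.I * (ξ : ℂ) * (x : ℂ)) / ((1 + |ξ| ^ σ : ℝ) : ℂ) := by
  refine (aux_m_integrable σ hσ1).mono' (aux_G_integrand_cont σ hσ1 x).aestronglyMeasurable
    (ae_of_all _ fun ξ => (aux_G_integrand_norm σ x ξ).le)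

lemma aux_G_cont (σ : ℝ) (hσ1 : 1 < σ) : Continuous (Gsigma σ) := by
  unfold Gsigma
  refine continuous_const.mul (Complex.continuous_re.comp ?_)
  refine continuous_of_dominated (bound := fun ξ => (1 + |ξ| ^ σ)⁻¹)
    (fun x => (aux_G_integrand_cont σ hσ1 x).aestronglyMeasurable)
    (fun x => ae_of_all _ fun ξ => (aux_G_integrand_norm σ x ξ).le) (aux_m_integrable σ hσ1)
    (ae_of_all _ fun ξ => by fun_prop)

lemma aux_G_eq (σ : ℝ) (hσ1 : 1 < σ) (x : ℝ) :
    Gsigma σ x = (1 / π) * ∫ ξ in Set.Ioi (0:ℝ), Real.cos (ξ * |x|) * (1 + ξ ^ σ)⁻¹ := by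
  unfold Gsigma
  have h1 := integral_re (𝕜 := ℂ) (aux_G_integrable σ hσ1 x)
  simp only [RCLike.re_to_complex] at h1
  rw [← h1]
  have h2 : ∀ ξ : ℝ, (Complex.exp (Complex.I * (ξ : ℂ) * (x : ℂ)) / ((1 + |ξ| ^ σ : ℝ) : ℂ)).re
      = (fun t => Real.cos (t * |x|) * (1 + t ^ σ)⁻¹) |ξ| := by
    intro ξ
    rw [Complex.div_ofReal_re]
    have : Complex.I * (ξ : ℂ) * (x : ℂ) = ((ξ * x : ℝ) : ℂ) * Complex.I := by push_cast; ring
    rw [this, Complex.exp_ofReal_mul_I_re, div_eq_mul_inv]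
    simp only
    rw [← abs_mul, Real.cos_abs]
  rw [integral_congr_ae (ae_of_all _ h2), integral_comp_abs (f := fun t => Real.cos (t * |x|) * (1 + t ^ σ)⁻¹)]
  rw [← mul_assoc]
  congr 1
  field_simp

lemma aux_G_bdd (σ : ℝ) : ∃ C, ∀ x, |Gsigma σ x| ≤ C := by
  refine ⟨(1 / (2 * π)) * ∫ ξ : ℝ, (1 + |ξ| ^ σ)⁻¹, fun x => ?_⟩
  unfold Gsigma
  rw [abs_mul, abs_of_pos (by positivity)]
  gcongr
  refine (Complex.abs_re_le_norm _).trans ((norm_integral_le_integral_norm _).trans ?_)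
  simp only [aux_G_integrand_norm]
  exact le_rfl

lemma aux_rect (σ : ℝ) (hσ1 : 1 < σ) (hσ2 : σ < 2) : ∃ c : ℝ, 0 < c ∧ ∀ x : ℝ, 0 < x → ∀ R : ℝ,
    0 < R → |∫ ξ in (0:ℝ)..R, Real.cos (ξ * x) * (1 + ξ ^ σ)⁻¹| ≤
      (c⁻¹)^2 * ((1 / x) ^ (σ + 1) * Real.Gamma (σ + 1)) + 2 * (c⁻¹ * R ^ (1 - σ)) := by
  obtain ⟨c, hc, hlow⟩ := aux_lower σ hσ1 hσ2
  refine ⟨c, hc, fun x hx R hR => ?_⟩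
  have hσ0 : 0 < σ := by linarith
  set f : ℂ → ℂ := fun z => Complex.exp (Complex.I * z * x) / (1 + z ^ (σ : ℂ)) with hf
  have hne : ∀ z : ℂ, 0 ≤ z.re → 0 ≤ z.im → 1 + z ^ (σ : ℂ) ≠ 0 := fun z h1 h2 =>
    norm_pos_iff.1 (hc.trans_le (hlow z h1 h2).1)
  have hcont : ∀ z : ℂ, 0 ≤ z.re → 0 ≤ z.im → ContinuousAt f z := by
    intro z h1 h2
    refine ContinuousAt.div (by fun_prop) (continuousAt_const.add ?_) (hne z h1 h2)
    exact Complex.continuousAt_cpow_const_of_re_pos (Or.inl h1) (by simpa using hσ0)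
  have hrect := Complex.integral_boundary_rect_eq_zero_of_continuousOn_of_differentiableOn f 0
    (R + R * Complex.I) ?_ ?_
  rotate_left
  · intro z hz
    simp [Complex.mem_reProdIm, Set.uIcc_of_le hR.le] at hz
    exact (hcont z hz.1.1 hz.2.1).continuousWithinAt
  · intro z hz
    simp [Complex.mem_reProdIm, hR.le] at hz
    refine DifferentiableAt.differentiableWithinAt ?_
    refine DifferentiableAt.div (by fun_prop) ?_ (hne z hz.1.1.le hz.2.1.le)
    exact (differentiableAt_const _).add (differentiableAt_id.cpow_const (Or.inl hz.1.1))
  simp at hrect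
  have hnf : ∀ z : ℂ, 0 ≤ z.re → 0 ≤ z.im → R ≤ ‖z‖ → ‖f z‖ ≤ c⁻¹ * R ^ (-σ) := by
    intro z h1 h2 h3
    rw [hf]
    simp only [norm_div]
    have he : ‖Complex.exp (Complex.I * z * x)‖ ≤ 1 := by
      rw [Complex.norm_exp]
      simp
      positivity
    have hR' : c * R ^ σ ≤ ‖1 + z ^ (σ : ℂ)‖ := by
      refine le_trans ?_ (hlow z h1 h2).2
      gcongr
    rw [Real.rpow_neg hR.le, ← mul_inv, ← one_div]
    gcongr
  have hRR : c⁻¹ * R ^ (-σ) * |R - 0| = c⁻¹ * R ^ (1 - σ) := by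
    rw [sub_zero, abs_of_pos hR, sub_eq_add_neg, Real.rpow_add hR, Real.rpow_one]; ring
  have htop : ‖∫ t in (0:ℝ)..R, f (t + R * Complex.I)‖ ≤ c⁻¹ * R ^ (1 - σ) := by
    rw [← hRR]
    refine intervalIntegral.norm_integral_le_of_norm_le_const fun t ht => ?_
    rw [Set.uIoc_of_le hR.le] at ht
    refine hnf _ (by simpa using ht.1.le) (by simpa using hR.le) ?_
    refine le_trans ?_ (Complex.abs_im_le_norm _)
    simp [abs_of_pos hR]
  have hright : ‖∫ t in (0:ℝ)..R, f (R + t * Complex.I)‖ ≤ c⁻¹ * R ^ (1 - σ) := by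
    rw [← hRR]
    refine intervalIntegral.norm_integral_le_of_norm_le_const fun t ht => ?_
    rw [Set.uIoc_of_le hR.le] at ht
    refine hnf _ (by simpa using hR.le) (by simpa using ht.1.le) ?_
    refine le_trans ?_ (Complex.abs_re_le_norm _)
    simp [abs_of_pos hR]
  have hbot : (∫ t in (0:ℝ)..R, f t).re = ∫ ξ in (0:ℝ)..R, Real.cos (ξ * x) * (1 + ξ ^ σ)⁻¹ := by
    have hi : IntervalIntegrable (fun t : ℝ => f t) volume 0 R := by
      refine ContinuousOn.intervalIntegrable fun t ht => ContinuousAt.continuousWithinAt ?_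
      rw [Set.uIcc_of_le hR.le] at ht
      exact ContinuousAt.comp (f := fun t : ℝ => (t : ℂ)) (hcont t (by simpa using ht.1) (by simp))
        (by fun_prop)
    rw [intervalIntegral.integral_of_le hR.le] at *
    have h1 := integral_re (𝕜 := ℂ) hi.1
    simp only [RCLike.re_to_complex] at h1
    rw [← h1, intervalIntegral.integral_of_le hR.le]
    refine setIntegral_congr_fun measurableSet_Ioc fun t ht => ?_
    have e1 : (1 + (t : ℂ) ^ (σ : ℂ)) = ((1 + t ^ σ : ℝ) : ℂ) := by
      rw [← Complex.ofReal_cpow ht.1.le]; push_cast; rfl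
    have e2 : Complex.I * (t : ℂ) * (x : ℂ) = ((t * x : ℝ) : ℂ) * Complex.I := by push_cast; ring
    simp only [hf]
    rw [e1, e2, Complex.div_ofReal_re, Complex.exp_ofReal_mul_I_re, div_eq_mul_inv]
  have hleft : |(Complex.I * ∫ t in (0:ℝ)..R, f (t * Complex.I)).re| ≤
      (c⁻¹)^2 * ((1 / x) ^ (σ + 1) * Real.Gamma (σ + 1)) := by
    have hi : IntervalIntegrable (fun t : ℝ => Complex.I * f (t * Complex.I)) volume 0 R := by
      refine ContinuousOn.intervalIntegrable fun t ht => ContinuousAt.continuousWithinAt ?_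
      rw [Set.uIcc_of_le hR.le] at ht
      refine continuousAt_const.mul ?_
      exact ContinuousAt.comp (f := fun t : ℝ => (t : ℂ) * Complex.I)
        (hcont _ (by simp) (by simpa using ht.1)) (by fun_prop)
    have hgam := Real.integral_rpow_mul_exp_neg_mul_Ioi (a := σ + 1) (by linarith) hx
    have hgi : IntegrableOn (fun t : ℝ => (c⁻¹)^2 * (t ^ (σ + 1 - 1) * Real.exp (-(x * t))))
        (Set.Ioi 0) := by
      refine Integrable.const_mul ?_ _
      by_contra hcon
      rw [integral_undef hcon] at hgam
      have : 0 < (1 / x) ^ (σ + 1) * Real.Gamma (σ + 1) :=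
        mul_pos (by positivity) (Real.Gamma_pos_of_pos (by linarith))
      linarith
    rw [← intervalIntegral.integral_const_mul, intervalIntegral.integral_of_le hR.le]
    have h1 := integral_re (𝕜 := ℂ) hi.1
    simp only [RCLike.re_to_complex] at h1
    rw [← h1, ← hgam, ← integral_const_mul, ← Real.norm_eq_abs]
    refine (norm_integral_le_of_norm_le (hgi.mono_set Set.Ioc_subset_Ioi_self) ?_).trans ?_
    · refine (ae_restrict_iff' measurableSet_Ioc).2 (ae_of_all _ fun t ht => ?_)
      have ht0 : 0 < t := ht.1
      have hz1 : 0 ≤ ((t:ℂ) * Complex.I).re := by simp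
      have hz2 : 0 ≤ ((t:ℂ) * Complex.I).im := by simpa using ht0.le
      have hl := (hlow _ hz1 hz2).1
      have e2 : Complex.I * ((t : ℂ) * Complex.I) * (x : ℂ) = ((-(x * t) : ℝ) : ℂ) := by
        push_cast; linear_combination (t * x : ℂ) * Complex.I_sq
      simp only [hf]
      rw [e2, ← Complex.ofReal_exp]
      set u := 1 + ((t:ℂ) * Complex.I) ^ (σ : ℂ) with hu
      have e3 : (Complex.I * (((Real.exp (-(x * t)) : ℝ) : ℂ) / u)).re =
          Real.exp (-(x * t)) * (u.im / ‖u‖ ^ 2) := by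
        rw [Complex.I_mul_re, div_eq_mul_inv, Complex.im_ofReal_mul, Complex.inv_im,
          Complex.normSq_eq_norm_sq]
        ring
      have e4 : |u.im| ≤ t ^ σ := by
        have : u.im = (((t:ℂ) * Complex.I) ^ (σ : ℂ)).im := by simp [hu]
        rw [this]
        refine (Complex.abs_im_le_norm _).trans ?_
        rw [Complex.norm_cpow_real]
        simp [abs_of_pos ht0]
      rw [e3, Real.norm_eq_abs, abs_mul, abs_of_pos (Real.exp_pos _), abs_div,
        abs_of_nonneg (sq_nonneg ‖u‖), add_sub_cancel_right]
      have : |u.im| / ‖u‖ ^ 2 ≤ t ^ σ / c ^ 2 := by gcongr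
      calc _ ≤ Real.exp (-(x * t)) * (t ^ σ / c ^ 2) := by gcongr
        _ = _ := by field_simp
    · refine setIntegral_mono_set hgi ?_ (Set.Ioc_subset_Ioi_self.eventuallyLE)
      refine (ae_restrict_iff' measurableSet_Ioi).2 (ae_of_all _ fun t ht => ?_)
      have ht0 : 0 < t := ht
      simp only [Pi.zero_apply]
      positivity
  have hfin : (∫ t in (0:ℝ)..R, f t) = (∫ t in (0:ℝ)..R, f (t + R * Complex.I))
      - Complex.I * (∫ t in (0:ℝ)..R, f (R + t * Complex.I))
      + Complex.I * (∫ t in (0:ℝ)..R, f (t * Complex.I)) := by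
    linear_combination hrect
  rw [← hbot, hfin, Complex.add_re, Complex.sub_re]
  have g1 := (Complex.abs_re_le_norm _).trans htop
  have g2 : |(Complex.I * (∫ t in (0:ℝ)..R, f (R + t * Complex.I))).re| ≤ c⁻¹ * R ^ (1 - σ) := by
    refine (Complex.abs_re_le_norm _).trans ?_
    rw [norm_mul, Complex.norm_I, one_mul]; exact hright
  rw [abs_le] at *
  constructor <;> linarith [g1.1, g1.2, g2.1, g2.2, hleft.1, hleft.2]

noncomputable def ww (σ x : ℝ) : ℝ := (1 + x ^ 2) ^ (-(1 + σ) / 2)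

lemma ww_pos (σ x : ℝ) : 0 < ww σ x := by unfold ww; positivity

lemma ww_cont (σ : ℝ) : Continuous (ww σ) := by
  unfold ww
  exact (by fun_prop : Continuous fun x : ℝ => 1 + x ^ 2).rpow_const
    fun x => Or.inl (by positivity)

lemma ww_integrable (σ : ℝ) (hσ : 1 < σ) : Integrable (ww σ) := by
  have h := integrable_rpow_neg_one_add_norm_sq (E := ℝ) (μ := volume) (r := 1 + σ)
    (by simp; linarith)
  have e : ww σ = fun x : ℝ => (1 + ‖x‖ ^ 2) ^ (-(1 + σ) / 2) := by
    funext x; simp only [ww, Real.norm_eq_abs, sq_abs]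
  rw [e]; exact h

lemma ww_le_of (σ : ℝ) (hσ : 1 < σ) (x y : ℝ) (h : |x| / 2 ≤ |y|) :
    ww σ y ≤ 4 ^ ((1 + σ) / 2) * ww σ x := by
  unfold ww
  have h1 : (1 + x ^ 2) / 4 ≤ 1 + y ^ 2 := by
    have : (|x| / 2) ^ 2 ≤ |y| ^ 2 := by gcongr
    rw [div_pow, sq_abs, sq_abs] at this
    linarith
  have h2 : (1 + y ^ 2) ^ (-(1 + σ) / 2) ≤ ((1 + x ^ 2) / 4) ^ (-(1 + σ) / 2) :=
    Real.rpow_le_rpow_of_nonpos (by positivity) h1 (by linarith)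
  refine h2.trans (le_of_eq ?_)
  rw [Real.div_rpow (by positivity) (by norm_num), neg_div, Real.rpow_neg (by norm_num : (0:ℝ) ≤ 4)]
  field_simp

lemma ww_mul (σ : ℝ) (hσ : 1 < σ) (x y : ℝ) :
    ww σ (x - y) * ww σ y ≤ 4 ^ ((1 + σ) / 2) * ww σ x * (ww σ (x - y) + ww σ y) := by
  have p1 := ww_pos σ x
  have p2 := ww_pos σ y
  have p3 := ww_pos σ (x - y)
  have p4 : (0:ℝ) < 4 ^ ((1 + σ) / 2) := by positivity
  have : |x| ≤ |x - y| + |y| := by simpa using abs_add_le (x - y) y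
  rcases le_total (|x| / 2) |y| with h | h
  · have := ww_le_of σ hσ x y h
    have h3 : 0 < 4 ^ ((1 + σ) / 2) * ww σ x * ww σ y := by positivity
    nlinarith [mul_le_mul_of_nonneg_left this p3.le]
  · have := ww_le_of σ hσ x (x - y) (by linarith)
    have h3 : 0 < 4 ^ ((1 + σ) / 2) * ww σ x * ww σ (x - y) := by positivity
    nlinarith [mul_le_mul_of_nonneg_right this p2.le]

lemma aux_G_decay (σ : ℝ) (hσ1 : 1 < σ) (hσ2 : σ < 2) :
    ∃ C, 0 < C ∧ ∀ x, |Gsigma σ x| ≤ C * ww σ x := by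
  obtain ⟨c, hc, hrect⟩ := aux_rect σ hσ1 hσ2
  obtain ⟨B, hB⟩ := aux_G_bdd σ
  have hB0 : 0 ≤ B := (abs_nonneg _).trans (hB 0)
  set K := (1 / π) * ((c⁻¹)^2 * Real.Gamma (σ + 1)) with hK
  have hG : 0 < Real.Gamma (σ + 1) := Real.Gamma_pos_of_pos (by linarith)
  have hK0 : 0 < K := by positivity
  have hpt : ∀ x, x ≠ 0 → |Gsigma σ x| ≤ K * |x| ^ (-(1 + σ)) := by
    intro x hx
    have hx0 : 0 < |x| := abs_pos.2 hx
    rw [aux_G_eq σ hσ1, abs_mul, abs_of_pos (by positivity : 0 < 1 / π)]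
    have hint : IntegrableOn (fun ξ : ℝ => Real.cos (ξ * |x|) * (1 + ξ ^ σ)⁻¹) (Set.Ioi 0) := by
      have h0 : IntegrableOn (fun ξ : ℝ => Real.cos (ξ * |x|) * (1 + |ξ| ^ σ)⁻¹) (Set.Ioi 0) := by
        refine Integrable.integrableOn ?_
        refine (aux_m_integrable σ hσ1).bdd_mul (c := 1)
          (by fun_prop : Continuous fun ξ : ℝ => Real.cos (ξ * |x|)).aestronglyMeasurable
          (ae_of_all _ fun ξ => ?_)
        exact Real.abs_cos_le_one _
      refine h0.congr_fun (fun ξ hξ => ?_) measurableSet_Ioi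
      simp only [abs_of_pos (Set.mem_Ioi.1 hξ)]
    have hl := (intervalIntegral_tendsto_integral_Ioi 0 hint tendsto_id).abs
    have hr : Tendsto (fun R : ℝ => (c⁻¹)^2 * ((1 / |x|) ^ (σ + 1) * Real.Gamma (σ + 1))
        + 2 * (c⁻¹ * R ^ (1 - σ))) atTop
        (nhds ((c⁻¹)^2 * ((1 / |x|) ^ (σ + 1) * Real.Gamma (σ + 1)) + 2 * (c⁻¹ * 0))) := by
      refine tendsto_const_nhds.add (Tendsto.const_mul _ (Tendsto.const_mul _ ?_))
      have := tendsto_rpow_neg_atTop (y := σ - 1) (by linarith)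
      simpa using this
    have hle := le_of_tendsto_of_tendsto hl hr (by
      filter_upwards [eventually_gt_atTop 0] with R hR
      exact hrect |x| hx0 R hR)
    have e : (1 / |x|) ^ (σ + 1) = |x| ^ (-(1 + σ)) := by
      rw [one_div, Real.inv_rpow hx0.le, Real.rpow_neg hx0.le, add_comm]
    rw [e] at hle
    calc _ ≤ (1 / π) * ((c⁻¹)^2 * (|x| ^ (-(1 + σ)) * Real.Gamma (σ + 1)) + 2 * (c⁻¹ * 0)) := by
          gcongr
      _ = _ := by rw [hK]; ring
  have p4 : (0:ℝ) < 2 ^ ((1 + σ) / 2) := by positivity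
  refine ⟨(B + K) * 2 ^ ((1 + σ) / 2), by positivity, fun x => ?_⟩
  have hw : ∀ t : ℝ, 0 < t → 1 + x ^ 2 ≤ 2 * t ^ 2 →
      t ^ (-(1 + σ)) ≤ 2 ^ ((1 + σ) / 2) * ww σ x := by
    intro t ht h
    have h2 : (2 * t ^ 2) ^ (-(1 + σ) / 2) ≤ ww σ x :=
      Real.rpow_le_rpow_of_nonpos (by positivity) h (by linarith)
    have h3 : (2 * t ^ 2) ^ (-(1 + σ) / 2) = (2 ^ ((1 + σ) / 2))⁻¹ * t ^ (-(1 + σ)) := by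
      rw [Real.mul_rpow (by norm_num) (by positivity), neg_div, Real.rpow_neg (by norm_num),
        ← Real.rpow_natCast, ← Real.rpow_mul ht.le]
      congr 2
      push_cast; ring
    rw [h3, inv_mul_le_iff₀ p4] at h2
    exact h2
  have hwx := ww_pos σ x
  rcases le_total |x| 1 with h | h
  · have h1 := hw 1 one_pos (by
      have : |x| ^ 2 ≤ 1 ^ 2 := by gcongr
      rw [sq_abs] at this; linarith)
    rw [Real.one_rpow] at h1
    refine (hB x).trans ?_
    have : 0 < K * (2 ^ ((1 + σ) / 2) * ww σ x) := by positivity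
    nlinarith
  · have hx0 : 0 < |x| := by linarith
    have h1 := hw |x| hx0 (by
      have : 1 ^ 2 ≤ |x| ^ 2 := by gcongr
      rw [sq_abs] at *; linarith)
    refine (hpt x (abs_pos.1 hx0)).trans ?_
    have : 0 ≤ B * (2 ^ ((1 + σ) / 2) * ww σ x) := by positivity
    nlinarith [mul_le_mul_of_nonneg_left h1 hK0.le]

/-- Convolution bound. -/
lemma aux_conv (σ : ℝ) (hσ1 : 1 < σ) (hσ2 : σ < 2) : ∃ C, 0 < C ∧ ∀ (F : ℝ → ℝ) (A b : ℝ),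
    0 ≤ A → 0 ≤ b → (∀ y, |F y| ≤ A * ww σ y + b) →
    ∀ x, |∫ y, Gsigma σ (x - y) * F y| ≤ C * (A * ww σ x + b) := by
  obtain ⟨C, hC, hG⟩ := aux_G_decay σ hσ1 hσ2
  have hwi := ww_integrable σ hσ1
  set W := ∫ y, ww σ y with hW
  have hW0 : 0 ≤ W := integral_nonneg fun y => (ww_pos σ y).le
  set D : ℝ := 4 ^ ((1 + σ) / 2) with hD
  have hD1 : 1 ≤ D := Real.one_le_rpow (by norm_num) (by linarith)
  refine ⟨C * (2 * D * W + 1), by positivity, fun F A b hA hb hF x => ?_⟩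
  have hwi' : Integrable fun y => ww σ (x - y) := hwi.comp_sub_left x
  rw [← Real.norm_eq_abs]
  have hbi : Integrable fun y => C * (A * (D * ww σ x * (ww σ (x - y) + ww σ y)) +
      ww σ (x - y) * b) :=
    ((((hwi'.add hwi).const_mul _).const_mul A).add (hwi'.mul_const b)).const_mul C
  refine (norm_integral_le_of_norm_le hbi (ae_of_all _ fun y => ?_)).trans ?_
  · rw [Real.norm_eq_abs, abs_mul]
    have h1 := hG (x - y)
    have h2 := ww_mul σ hσ1 x y
    have h3 := ww_pos σ (x - y)
    calc |Gsigma σ (x - y)| * |F y| ≤ (C * ww σ (x - y)) * (A * ww σ y + b) :=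
          mul_le_mul h1 (hF y) (abs_nonneg _) (by positivity)
      _ = C * (A * (ww σ (x - y) * ww σ y) + ww σ (x - y) * b) := by ring
      _ ≤ _ := by gcongr
  · have hi1 : Integrable fun y => A * (D * ww σ x * (ww σ (x - y) + ww σ y)) :=
      ((hwi'.add hwi).const_mul _).const_mul A
    rw [integral_const_mul, integral_add hi1 (hwi'.mul_const b), integral_const_mul, integral_const_mul, integral_add hwi' hwi,
      integral_mul_const, integral_sub_left_eq_self (ww σ) volume x, ← hW, mul_assoc C]
    have hwx := ww_pos σ x
    have : 0 ≤ A * ww σ x := by positivity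
    refine mul_le_mul_of_nonneg_left ?_ hC.le
    have h5 : 0 ≤ (2 * D - 1) * W * b := by
      have : 0 ≤ 2 * D - 1 := by linarith
      positivity
    nlinarith

/-- Bounded smooth functions. -/
def BS (f : ℝ → ℝ) : Prop :=
  ContDiff ℝ (⊤ : ℕ∞) f ∧ ∀ l : ℕ, ∃ M : ℝ, ∀ x : ℝ, |iteratedDeriv l f x| ≤ M

lemma iterMul {f g : ℝ → ℝ} (hf : ContDiff ℝ (⊤ : ℕ∞) f) (hg : ContDiff ℝ (⊤ : ℕ∞) g)
    (l : ℕ) (x : ℝ) : iteratedDeriv l (f * g) x = ∑ i ∈ Finset.range (l + 1),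
      (l.choose i : ℝ) * iteratedDeriv i f x * iteratedDeriv (l - i) g x := by
  exact iteratedDeriv_mul ((hf.of_le (by exact_mod_cast le_top)).contDiffAt)
    ((hg.of_le (by exact_mod_cast le_top)).contDiffAt)

lemma BS.mul {f g : ℝ → ℝ} (hf : BS f) (hg : BS g) : BS (f * g) := by
  refine ⟨hf.1.mul hg.1, fun l => ?_⟩
  choose M hM using hf.2
  choose N hN using hg.2
  refine ⟨∑ i ∈ Finset.range (l + 1), (l.choose i : ℝ) * M i * N (l - i), fun x => ?_⟩
  rw [iterMul hf.1 hg.1]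
  refine (Finset.abs_sum_le_sum_abs _ _).trans (Finset.sum_le_sum fun i _ => ?_)
  have h0 := (abs_nonneg _).trans (hM i x)
  rw [abs_mul, abs_mul, Nat.abs_cast]
  have := hM i x
  have := hN (l - i) x
  gcongr

lemma BS.const (c : ℝ) : BS (fun _ => c) := by
  refine ⟨contDiff_const, fun l => ⟨|c|, fun x => ?_⟩⟩
  rw [iteratedDeriv_const]
  split_ifs <;> simp

lemma BS.pow {f : ℝ → ℝ} (hf : BS f) (n : ℕ) : BS (f ^ n) := by
  induction n with
  | zero => simpa using! BS.const 1
  | succ n ih => rw [pow_succ]; exact ih.mul hf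

lemma BS.add {f g : ℝ → ℝ} (hf : BS f) (hg : BS g) : BS (f + g) := by
  refine ⟨hf.1.add hg.1, fun l => ?_⟩
  obtain ⟨M, hM⟩ := hf.2 l
  obtain ⟨N, hN⟩ := hg.2 l
  refine ⟨M + N, fun x => ?_⟩
  rw [iteratedDeriv_add ((hf.1.of_le (by exact_mod_cast le_top)).contDiffAt)
    ((hg.1.of_le (by exact_mod_cast le_top)).contDiffAt)]
  exact (abs_add_le _ _).trans (add_le_add (hM x) (hN x))

lemma aux_G_int (σ : ℝ) (hσ1 : 1 < σ) (hσ2 : σ < 2) : Integrable (Gsigma σ) := by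
  obtain ⟨C, hC, hG⟩ := aux_G_decay σ hσ1 hσ2
  exact ((ww_integrable σ hσ1).const_mul C).mono' (aux_G_cont σ hσ1).aestronglyMeasurable
    (ae_of_all _ hG)

lemma conv_swap (g F : ℝ → ℝ) (x : ℝ) : ∫ y, g (x - y) * F y = ∫ y, g y * F (x - y) := by
  rw [← integral_sub_left_eq_self (fun y => g y * F (x - y)) volume x]
  simp

lemma conv_iteratedDeriv (g F φ : ℝ → ℝ) (hg : Integrable g) (hF : BS F)
    (h : ∀ x, φ x = ∫ y, g (x - y) * F y) (l : ℕ) :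
    ∀ x, iteratedDeriv l φ x = ∫ y, g (x - y) * iteratedDeriv l F y := by
  induction l with
  | zero => simpa using h
  | succ l ih =>
    intro x
    have hdiff : ∀ k, ContDiff ℝ 1 (iteratedDeriv k F) := fun k =>
      by
        rw [iteratedDeriv_eq_iterate]
        exact ContDiff.iterate_deriv' 1 k (hF.1.of_le (by exact_mod_cast le_top))
    have hd : ∀ x, HasDerivAt (iteratedDeriv l F) (iteratedDeriv (l + 1) F x) x := by
      intro x
      rw [iteratedDeriv_succ]
      exact ((hdiff l).differentiable (by norm_num) x).hasDerivAt
    obtain ⟨M, hM⟩ := hF.2 l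
    obtain ⟨N, hN⟩ := hF.2 (l + 1)
    have hfun : iteratedDeriv l φ = fun x => ∫ y, g y * iteratedDeriv l F (x - y) := by
      funext x; rw [ih, conv_swap]
    rw [iteratedDeriv_succ, hfun, conv_swap]
    refine (hasDerivAt_integral_of_dominated_loc_of_deriv_le (s := Set.univ)
      (F' := fun x y => g y * iteratedDeriv (l + 1) F (x - y))
      (bound := fun y => ‖g y‖ * N) univ_mem ?_ ?_ ?_ ?_ ?_ ?_).2.deriv
    · refine Eventually.of_forall fun x => ?_
      exact hg.1.mul ((hdiff l).continuous.comp (by fun_prop)).aestronglyMeasurable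
    · refine hg.mul_bdd (c := M) ?_ ?_
      · exact ((hdiff l).continuous.comp (by fun_prop)).aestronglyMeasurable
      · exact ae_of_all _ fun y => hM _
    · exact hg.1.mul ((hdiff (l + 1)).continuous.comp (by fun_prop)).aestronglyMeasurable
    · refine ae_of_all _ fun y x _ => ?_
      rw [norm_mul]
      exact mul_le_mul_of_nonneg_left (hN _) (norm_nonneg _)
    · exact hg.norm.mul_const N
    · refine ae_of_all _ fun y x _ => ?_
      have := (hd (x - y)).comp x ((hasDerivAt_id x).sub_const y)
      simpa using! this.const_mul (g y)

/-- If `φ` is smooth with all derivatives bounded, vanishes at infinity, and solves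
`φ = G_σ ∗ (a₁ φ^p + a₂ φ^q)`, then every derivative satisfies
`|∂_x^l φ(x)| ≤ C_l ⟨x⟩^{−(1+σ)}`. -/
theorem derivatives_polynomial_decay (σ : ℝ) (hσ1 : 1 < σ) (hσ2 : σ < 2)
    (p q : ℕ) (hp : 2 ≤ p) (hpq : p < q) (a₁ a₂ : ℝ) (φ : ℝ → ℝ)
    (hsmooth : ContDiff ℝ (⊤ : ℕ∞) φ)
    (hbdd : ∀ l : ℕ, ∃ M : ℝ, ∀ x : ℝ, |iteratedDeriv l φ x| ≤ M)
    (hdecay : Tendsto φ (cocompact ℝ) (nhds 0))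
    (heq : ∀ x : ℝ, φ x = ∫ y : ℝ, Gsigma σ (x - y) * (a₁ * φ y ^ p + a₂ * φ y ^ q)) :
    ∀ l : ℕ, ∃ C : ℝ, 0 < C ∧
      ∀ x : ℝ, |iteratedDeriv l φ x| ≤ C * (1 + x ^ 2) ^ (-(1 + σ) / 2) := by
  change ∀ l : ℕ, ∃ C : ℝ, 0 < C ∧ ∀ x : ℝ, |iteratedDeriv l φ x| ≤ C * ww σ x
  obtain ⟨p, rfl⟩ : ∃ p', p = p' + 2 := ⟨p - 2, by omega⟩
  obtain ⟨q, rfl⟩ : ∃ q', q = q' + 2 := ⟨q - 2, by omega⟩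
  have hφ : BS φ := ⟨hsmooth, hbdd⟩
  set h : ℝ → ℝ := (fun _ => a₁) * φ ^ p + (fun _ => a₂) * φ ^ q with hh
  have hhB : BS h := ((BS.const a₁).mul (hφ.pow p)).add ((BS.const a₂).mul (hφ.pow q))
  have hgB : BS (φ * h) := hφ.mul hhB
  have hFB : BS (φ * (φ * h)) := hφ.mul hgB
  have heq' : ∀ x, φ x = ∫ y, Gsigma σ (x - y) * (φ * (φ * h)) y := by
    intro x
    rw [heq x]
    congr 1; funext y
    simp only [hh, Pi.mul_apply, Pi.add_apply, Pi.pow_apply]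
    ring
  obtain ⟨C, hC, hconv⟩ := aux_conv σ hσ1 hσ2
  obtain ⟨B, hB⟩ := hφ.2 0
  obtain ⟨H, hH⟩ := hhB.2 0
  simp only [iteratedDeriv_zero] at hB hH
  have hB0 : 0 ≤ B := (abs_nonneg _).trans (hB 0)
  have hH0 : 0 ≤ H := (abs_nonneg _).trans (hH 0)
  -- base case
  have base : ∃ A : ℝ, 0 < A ∧ ∀ x, |φ x| ≤ A * ww σ x := by
    set ε : ℝ := 1 / (2 * C) with hε
    have hε0 : 0 < ε := by positivity
    have hg0 : Tendsto (φ * h) (cocompact ℝ) (nhds 0) := by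
      have h1 : Tendsto (fun x => |φ x| * H) (cocompact ℝ) (nhds (|0| * H)) :=
        hdecay.abs.mul_const H
      rw [abs_zero, zero_mul] at h1
      refine squeeze_zero_norm (fun x => ?_) h1
      rw [Pi.mul_apply, Real.norm_eq_abs, abs_mul]
      exact mul_le_mul_of_nonneg_left (hH x) (abs_nonneg _)
    have hev : ∀ᶠ x in cocompact ℝ, |(φ * h) x| < ε := by
      have := hg0.abs
      rw [abs_zero] at this
      exact this.eventually (gt_mem_nhds hε0)
    obtain ⟨S, hS, hSε⟩ := mem_cocompact.1 hev
    obtain ⟨δ, hδ, hδS⟩ : ∃ δ > 0, ∀ y ∈ S, δ ≤ ww σ y := by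
      rcases S.eq_empty_or_nonempty with hE | hne
      · exact ⟨1, one_pos, by simp [hE]⟩
      · obtain ⟨y, hy, hmin⟩ := hS.exists_isMinOn hne (ww_cont σ).continuousOn
        exact ⟨ww σ y, ww_pos σ y, fun z hz => hmin hz⟩
    set M := B * (B * H) / δ with hM
    have hM0 : 0 ≤ M := by positivity
    have hFb : ∀ y, |(φ * (φ * h)) y| ≤ M * ww σ y + ε * |φ y| := by
      intro y
      have hwy := ww_pos σ y
      by_cases hy : y ∈ S
      · have h1 : |(φ * (φ * h)) y| ≤ B * (B * H) := by
          simp only [Pi.mul_apply, abs_mul]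
          have := hB y
          have := hH y
          gcongr
        have h2 : B * (B * H) ≤ M * ww σ y := by
          have := mul_le_mul_of_nonneg_left (hδS y hy) hM0
          rwa [hM, div_mul_cancel₀ _ hδ.ne'] at this
        have : 0 ≤ ε * |φ y| := by positivity
        linarith
      · have h1 : |(φ * h) y| < ε := hSε hy
        have h2 : |(φ * (φ * h)) y| = |(φ * h) y| * |φ y| := by
          rw [Pi.mul_apply, abs_mul, mul_comm]
        rw [h2]
        have := mul_le_mul_of_nonneg_right h1.le (abs_nonneg (φ y))
        have : 0 ≤ M * ww σ y := by positivity
        linarith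
    set A := 2 * C * M with hA
    have hA0 : 0 ≤ A := by positivity
    have hiter : ∀ n : ℕ, ∀ x, |φ x| ≤ A * ww σ x + B * (1 / 2) ^ n := by
      intro n
      induction n with
      | zero =>
        intro x
        have := hB x
        have : 0 ≤ A * ww σ x := mul_nonneg hA0 (ww_pos σ x).le
        simp; linarith
      | succ n ih =>
        intro x
        have h1 := hconv (φ * (φ * h)) (M + ε * A) (ε * (B * (1 / 2) ^ n)) (by positivity)
          (by positivity) (fun y => by
            have := mul_le_mul_of_nonneg_left (ih y) hε0.le
            have := hFb y
            linarith) x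
        rw [← heq' x] at h1
        refine h1.trans (le_of_eq ?_)
        rw [hA, hε, pow_succ]
        field_simp
        ring
    refine ⟨A + 1, by positivity, fun x => ?_⟩
    have hlim : Tendsto (fun n : ℕ => A * ww σ x + B * (1 / 2 : ℝ) ^ n) atTop
        (nhds (A * ww σ x + B * 0)) :=
      tendsto_const_nhds.add ((tendsto_pow_atTop_nhds_zero_of_lt_one (by norm_num)
        (by norm_num)).const_mul B)
    have := ge_of_tendsto' hlim fun n => hiter n x
    have hwx := ww_pos σ x
    linarith
  obtain ⟨A, hA, hAφ⟩ := base
  intro l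
  induction l using Nat.strong_induction_on with
  | _ l ih =>
  rcases Nat.eq_zero_or_pos l with rfl | hl
  · exact ⟨A, hA, by simpa using hAφ⟩
  obtain ⟨M, hM⟩ := hφ.2 l
  have hM0 : 0 ≤ M := (abs_nonneg _).trans (hM 0)
  choose N hN using hgB.2
  have hN0 : ∀ i, 0 ≤ N i := fun i => (abs_nonneg _).trans (hN i 0)
  have hterm : ∀ i ∈ Finset.range (l + 1), ∃ D : ℝ, 0 ≤ D ∧ ∀ x,
      |(l.choose i : ℝ) * iteratedDeriv i φ x * iteratedDeriv (l - i) (φ * h) x| ≤ D * ww σ x := by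
    intro i hi
    rcases Nat.lt_succ_iff_lt_or_eq.1 (Finset.mem_range.1 hi) with hlt | rfl
    · obtain ⟨E, hE, hEb⟩ := ih i hlt
      have := hN0 (l - i)
      refine ⟨(l.choose i : ℝ) * E * N (l - i), by positivity, fun x => ?_⟩
      have hwx := ww_pos σ x
      rw [abs_mul, abs_mul, Nat.abs_cast]
      calc _ ≤ (l.choose i : ℝ) * (E * ww σ x) * N (l - i) := by
            have := hEb x
            have := hN (l - i) x
            gcongr
        _ = _ := by ring
    · refine ⟨M * (A * H), by positivity, fun x => ?_⟩
      have hwx := ww_pos σ x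
      simp only [Nat.choose_self, Nat.cast_one, one_mul, Nat.sub_self, iteratedDeriv_zero,
        Pi.mul_apply, abs_mul]
      calc _ ≤ M * ((A * ww σ x) * H) := by
            have := hM x
            have := hAφ x
            have := hH x
            gcongr
        _ = _ := by ring
  choose! D hD0 hD using hterm
  have hFl : ∀ y, |iteratedDeriv l (φ * (φ * h)) y| ≤
      (∑ i ∈ Finset.range (l + 1), D i) * ww σ y + 0 := by
    intro y
    rw [iterMul hφ.1 hgB.1, add_zero, Finset.sum_mul]
    exact (Finset.abs_sum_le_sum_abs _ _).trans (Finset.sum_le_sum fun i hi => hD i hi y)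
  have hD0' : 0 ≤ ∑ i ∈ Finset.range (l + 1), D i := Finset.sum_nonneg hD0
  refine ⟨C * (∑ i ∈ Finset.range (l + 1), D i) + 1, by positivity, fun x => ?_⟩
  rw [conv_iteratedDeriv _ _ _ (aux_G_int σ hσ1 hσ2) hFB heq' l x]
  refine (hconv _ _ 0 hD0' le_rfl hFl x).trans ?_
  have hwx := ww_pos σ x
  linarith
end

section
/- Let φ be a real-valued Schwartz function on ℝ, set Λφ := (1/2)φ + x ∂_x φ and Φ(x) := ∫_{−∞}^x Λφ(y) dy, and let ρ ∈ C_c^∞(ℝ) satisfy 0 ≤ ρ ≤ 1, ρ(x) = 1 for |x| ≤ 1, and ρ(x) = 0 for |x| ≥ 2. Then lim_{A→+∞} ∫_ℝ φ(x) ∂_x[Φ(x) ρ(x/A)] dx = 0. -/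
open MeasureTheory Filter Real

/-- For a real Schwartz function `φ`, with `Λφ = (1/2)φ + x∂_xφ`,
`Φ(x) = ∫_{−∞}^x Λφ(y) dy`, and a cutoff `ρ`, one has
`∫_ℝ φ(x) ∂_x[Φ(x)ρ(x/A)] dx → 0` as `A → +∞`. -/
theorem virial_FA_limit (φ : SchwartzMap ℝ ℝ) (Λφ Φ : ℝ → ℝ)
    (hΛ : ∀ x : ℝ, Λφ x = (1 / 2) * φ x + x * deriv (⇑φ) x)
    (hΦ : ∀ x : ℝ, Φ x = ∫ y in Set.Iic x, Λφ y)
    (ρ : ℝ → ℝ) (hρsmooth : ContDiff ℝ (⊤ : ℕ∞) ρ) (hρsupp : HasCompactSupport ρ)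
    (hρ0 : ∀ x : ℝ, 0 ≤ ρ x) (hρ1 : ∀ x : ℝ, ρ x ≤ 1)
    (hρone : ∀ x : ℝ, |x| ≤ 1 → ρ x = 1) (hρzero : ∀ x : ℝ, 2 ≤ |x| → ρ x = 0) :
    Tendsto (fun A : ℝ => ∫ x : ℝ, φ x * deriv (fun y : ℝ => Φ y * ρ (y / A)) x)
      atTop (nhds 0) := by
  set ψ : SchwartzMap ℝ ℝ := SchwartzMap.derivCLM ℝ ℝ φ with hψdef
  have hψ : ∀ x, deriv (⇑φ) x = ψ x := fun x => by simp [hψdef]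
  have hΛe : Λφ = fun x => (1 / 2) * φ x + x * ψ x := by
    funext x; rw [hΛ, hψ]
  have hΛc : Continuous Λφ := by
    rw [hΛe]
    have := φ.continuous
    have := ψ.continuous
    fun_prop
  have hφi : Integrable (⇑φ) := φ.integrable
  have hxi : ∀ f : SchwartzMap ℝ ℝ, Integrable (fun x => x * f x) := fun f => by
    have h := f.integrable_pow_mul volume 1
    refine h.mono' ((continuous_id.mul f.continuous).aestronglyMeasurable) ?_
    exact Eventually.of_forall fun x => by simp
  have hΛi : Integrable Λφ := by
    rw [hΛe]
    exact (hφi.const_mul _).add (hxi ψ)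
  have hΦd : ∀ x, HasDerivAt Φ (Λφ x) x := by
    intro x
    have h1 : Φ = fun x => Φ 0 + ∫ y in (0:ℝ)..x, Λφ y := by
      funext z
      rw [← intervalIntegral.integral_Iic_sub_Iic hΛi.integrableOn hΛi.integrableOn,
        hΦ z, hΦ 0]
      ring
    rw [h1]
    exact (intervalIntegral.integral_hasDerivAt_right (hΛc.intervalIntegrable _ _)
      (hΛc.stronglyMeasurableAtFilter _ _) hΛc.continuousAt).const_add _
  have hΦb : ∀ x, ‖Φ x‖ ≤ ∫ y, ‖Λφ y‖ := by
    intro x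
    rw [hΦ]
    refine (norm_integral_le_integral_norm _).trans ?_
    exact setIntegral_le_integral hΛi.norm (Eventually.of_forall fun _ => norm_nonneg _)
  obtain ⟨C0, hC0⟩ := φ.decay 0 0
  obtain ⟨C1, hC1⟩ := ψ.decay 1 0
  have hφb : ∀ x, ‖φ x‖ ≤ C0 := fun x => by simpa using hC0.2 x
  have hψb : ∀ x, ‖x * ψ x‖ ≤ C1 := fun x => by simpa using hC1.2 x
  have hΛb : ∀ x, ‖Λφ x‖ ≤ C0 + C1 := fun x => by
    rw [hΛe]
    refine (norm_add_le _ _).trans (add_le_add ?_ (hψb x))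
    rw [norm_mul]
    have := hφb x
    have := norm_nonneg (φ x)
    norm_num at *
    linarith
  have hρd : Differentiable ℝ ρ := hρsmooth.differentiable (by simp)
  have hρ'c : Continuous (deriv ρ) := hρsmooth.continuous_deriv (by simp)
  obtain ⟨C2, hC2⟩ := hρsupp.deriv.exists_bound_of_continuous hρ'c
  have hder : ∀ A x, HasDerivAt (fun y : ℝ => Φ y * ρ (y / A))
      (Λφ x * ρ (x / A) + Φ x * (deriv ρ (x / A) * (1 / A))) x := by
    intro A x
    have h2 : HasDerivAt (fun y : ℝ => y / A) (1 / A) x := (hasDerivAt_id x).div_const A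
    exact (hΦd x).mul ((hρd (x / A)).hasDerivAt.comp x h2)
  have hΦc : Continuous Φ := continuous_iff_continuousAt.2 fun x => (hΦd x).continuousAt
  have hzero : ∫ x, φ x * Λφ x = 0 := by
    have hfi : Integrable (fun x => (1/2) * (x * φ x) * φ x) :=
      ((hxi φ).const_mul (1/2)).mul_bdd φ.continuous.aestronglyMeasurable
        (Eventually.of_forall hφb)
    have hf'i : Integrable (fun x => φ x * Λφ x) :=
      hφi.mul_bdd hΛc.aestronglyMeasurable (Eventually.of_forall hΛb)
    refine integral_eq_zero_of_hasDerivAt_of_integrable (fun x => ?_) hf'i hfi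
    have h1 : HasDerivAt (⇑φ) (ψ x) x := by
      rw [← hψ]; exact φ.differentiableAt.hasDerivAt
    have h2 := (((hasDerivAt_id x).mul h1).const_mul (1/2 : ℝ)).mul h1
    refine HasDerivAt.congr_deriv (f := fun x => (1/2) * (x * φ x) * φ x) h2 ?_
    rw [hΛe]; simp; ring
  rw [← hzero]
  have hfun : ∀ A x, deriv (fun y : ℝ => Φ y * ρ (y / A)) x = _ := fun A x => (hder A x).deriv
  simp only [hfun]
  refine tendsto_integral_filter_of_dominated_convergence
    (fun x => ‖φ x‖ * ((C0 + C1) + (∫ y, ‖Λφ y‖) * C2)) ?_ ?_ ?_ ?_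
  · refine Eventually.of_forall fun A => Continuous.aestronglyMeasurable ?_
    have := φ.continuous
    have := hρd.continuous
    fun_prop
  · filter_upwards [eventually_ge_atTop (1:ℝ)] with A hA
    refine Eventually.of_forall fun x => ?_
    rw [norm_mul]
    refine mul_le_mul_of_nonneg_left ((norm_add_le _ _).trans (add_le_add ?_ ?_)) (norm_nonneg _)
    · rw [norm_mul]
      have h1 : ‖ρ (x / A)‖ ≤ 1 := by
        rw [Real.norm_of_nonneg (hρ0 _)]; exact hρ1 _
      exact (mul_le_of_le_one_right (norm_nonneg _) h1).trans (hΛb x)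
    · rw [norm_mul, norm_mul]
      have h1 : ‖1 / A‖ ≤ 1 := by
        rw [Real.norm_of_nonneg (by positivity)]
        exact (div_le_one (by linarith)).2 hA
      exact mul_le_mul (hΦb x)
        ((mul_le_of_le_one_right (norm_nonneg _) h1).trans (hC2 _)) (by positivity)
        ((norm_nonneg _).trans (hΦb x))
  · exact hφi.norm.mul_const _
  · refine Eventually.of_forall fun x => ?_
    have h0 : Tendsto (fun A : ℝ => x / A) atTop (nhds 0) := tendsto_const_nhds.div_atTop tendsto_id
    have h1 : Tendsto (fun A : ℝ => ρ (x / A)) atTop (nhds (ρ 0)) :=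
      (hρd.continuous.tendsto 0).comp h0
    have h2 : Tendsto (fun A : ℝ => deriv ρ (x / A)) atTop (nhds (deriv ρ 0)) :=
      (hρ'c.tendsto 0).comp h0
    have h3 : Tendsto (fun A : ℝ => 1 / A) atTop (nhds 0) := tendsto_const_nhds.div_atTop tendsto_id
    have h4 := ((h1.const_mul (Λφ x)).add ((h2.mul h3).const_mul (Φ x))).const_mul (φ x)
    have h5 : ρ 0 = 1 := hρone 0 (by simp)
    simpa [h5] using h4
end
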